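/- arXiv:math/0106137 — 3 statements merged into one kernel-verified Lean document; each statement's English description precedes it below -/
import Mathlib

section
/- Let n, m ≥ 1 and let integers q_1,…,q_m and s_1,…,s_m be given. Let G be the presented group with generators b_{k,j}, d_{k,j} (k ∈ ℤ/n, 1 ≤ j ≤ m) and, for all k ∈ ℤ/n and 1 ≤ j ≤ m, relators expressing d_{k,j} = b_{k,j}^{s_j} b_{k,j+1}^{s_{j+1}} ⋯ b_{k,m}^{s_m} · b_{k-1,m}^{-s_m} b_{k-1,m-1}^{-s_{m-1}} ⋯ b_{k-1,j}^{-s_j} and b_{k,j} = d_{k,j}^{q_j} d_{k,j-1}^{q_{j-1}} ⋯ d_{k,1}^{q_1} · d_{k+1,1}^{-q_1} d_{k+1,2}^{-q_2} ⋯ d_{k+1,j}^{-q_j}. In the free group on generators x_k (k ∈ ℤ/n) define words recursively: D_{k,1} = x_k, B_{k,1} = x_k^{q_1} x_{k+1}^{-q_1}, and for 2 ≤ j ≤ m, D_{k,j} = B_{k,j-1}^{-s_{j-1}} D_{k,j-1} B_{k-1,j-1}^{s_{j-1}} and B_{k,j} = D_{k,j}^{q_j} B_{k,j-1} D_{k+1,j}^{-q_j};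 set w_k = B_{k,m}^{-s_m} D_{k,m} B_{k-1,m}^{s_m}. Then G is isomorphic to the presented group with generators x_k (k ∈ ℤ/n) and relators w_k for all k ∈ ℤ/n, via an isomorphism carrying d_{k,1} to x_k. -/
namespace Stmt2

/-- Ordered product `f j * f (j+1) * ⋯ * f (m-1)`. -/
def ascProd {G : Type*} [Monoid G] {m : ℕ} (f : Fin m → G) (j : Fin m) : G :=
  (((List.finRange m).filter (fun t => decide (j ≤ t))).map f).prod

/-- Ordered product `f j * f (j-1) * ⋯ * f 0`. -/
def descProd {G : Type*} [Monoid G] {m : ℕ} (f : Fin m → G) (j : Fin m) : G :=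
  ((((List.finRange m).filter (fun t => decide (t ≤ j))).reverse).map f).prod

/-- Generators `b_{k,j}`. Throughout, the `j` index is 0-based: the value `j : Fin m`
(resp. the coefficient index `j : ℕ`) corresponds to the paper's index `j+1`. -/
def bg {n m : ℕ} (k : ZMod n) (j : Fin m) :
    FreeGroup ((ZMod n × Fin m) ⊕ (ZMod n × Fin m)) :=
  FreeGroup.of (Sum.inl (k, j))

/-- Generators `d_{k,j}`. -/
def dg {n m : ℕ} (k : ZMod n) (j : Fin m) :
    FreeGroup ((ZMod n × Fin m) ⊕ (ZMod n × Fin m)) :=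
  FreeGroup.of (Sum.inr (k, j))

/-- Relators expressing
`d_{k,j} = b_{k,j}^{s_j} ⋯ b_{k,m}^{s_m} · b_{k-1,m}^{-s_m} ⋯ b_{k-1,j}^{-s_j}` and
`b_{k,j} = d_{k,j}^{q_j} ⋯ d_{k,1}^{q_1} · d_{k+1,1}^{-q_1} ⋯ d_{k+1,j}^{-q_j}`. -/
def relsLeft (n m : ℕ) (q s : ℕ → ℤ) :
    Set (FreeGroup ((ZMod n × Fin m) ⊕ (ZMod n × Fin m))) :=
  Set.range (fun kj : ZMod n × Fin m =>
    dg kj.1 kj.2 *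
      (ascProd (fun t => bg kj.1 t ^ s t.val) kj.2 *
        (ascProd (fun t => bg (kj.1 - 1) t ^ s t.val) kj.2)⁻¹)⁻¹) ∪
    Set.range (fun kj : ZMod n × Fin m =>
      bg kj.1 kj.2 *
        (descProd (fun t => dg kj.1 t ^ q t.val) kj.2 *
          (descProd (fun t => dg (kj.1 + 1) t ^ q t.val) kj.2)⁻¹)⁻¹)

/-- The recursively defined words `(D_{k,j}, B_{k,j})` in the free group on `x_k`,
`k ∈ ℤ/n` (`j` is 0-based): `D_{k,0} = x_k`, `B_{k,0} = x_k^{q_0} x_{k+1}^{-q_0}`,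
`D_{k,j+1} = B_{k,j}^{-s_j} D_{k,j} B_{k-1,j}^{s_j}` and
`B_{k,j+1} = D_{k,j+1}^{q_{j+1}} B_{k,j} D_{k+1,j+1}^{-q_{j+1}}`. -/
def DB (n : ℕ) (q s : ℕ → ℤ) :
    ℕ → (ZMod n → FreeGroup (ZMod n)) × (ZMod n → FreeGroup (ZMod n))
  | 0 =>
      (fun k => FreeGroup.of k,
       fun k => FreeGroup.of k ^ q 0 * FreeGroup.of (k + 1) ^ (-q 0))
  | j + 1 =>
      let P := DB n q s j
      let Dnew : ZMod n → FreeGroup (ZMod n) :=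
        fun k => P.2 k ^ (-s j) * P.1 k * P.2 (k - 1) ^ s j
      (Dnew, fun k => Dnew k ^ q (j + 1) * P.2 k * Dnew (k + 1) ^ (-q (j + 1)))

/-- The cyclic relator `w_k = B_{k,m}^{-s_m} D_{k,m} B_{k-1,m}^{s_m}`. -/
def w (n m : ℕ) (q s : ℕ → ℤ) (k : ZMod n) : FreeGroup (ZMod n) :=
  (DB n q s (m - 1)).2 k ^ (-s (m - 1)) * (DB n q s (m - 1)).1 k *
    (DB n q s (m - 1)).2 (k - 1) ^ s (m - 1)

theorem map_ascProd {G H : Type*} [Monoid G] [Monoid H] (φ : G →* H) {m : ℕ} (f : Fin m → G)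
    (j : Fin m) : φ (ascProd f j) = ascProd (fun t => φ (f t)) j := by
  simp [ascProd, map_list_prod, Function.comp_def]

theorem map_descProd {G H : Type*} [Monoid G] [Monoid H] (φ : G →* H) {m : ℕ} (f : Fin m → G)
    (j : Fin m) : φ (descProd f j) = descProd (fun t => φ (f t)) j := by
  simp [descProd, map_list_prod, Function.comp_def]

theorem ascProd_succ {G : Type*} [Monoid G] {m : ℕ} (f : Fin (m + 1) → G) (j : Fin m) :
    ascProd f j.succ = ascProd (fun t => f t.succ) j := by
  simp [ascProd, List.finRange_succ, List.filter_map, Function.comp_def]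

theorem ascProd_zero {G : Type*} [Monoid G] {m : ℕ} (f : Fin (m + 1) → G) :
    ascProd f 0 = f 0 * ((List.finRange m).map (fun t => f t.succ)).prod := by
  simp [ascProd, List.finRange_succ, Function.comp_def]

theorem descProd_succ {G : Type*} [Monoid G] {m : ℕ} (f : Fin (m + 1) → G) (j : Fin m) :
    descProd f j.succ = descProd (fun t => f t.succ) j * f 0 := by
  simp [descProd, List.finRange_succ, List.filter_map, Function.comp_def, List.map_reverse]

theorem descProd_zero {G : Type*} [Monoid G] {m : ℕ} (f : Fin (m + 1) → G) :
    descProd f 0 = f 0 := by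
  simp [descProd, List.finRange_succ, List.filter_map, Function.comp_def]

theorem ascProd_step {G : Type*} [Monoid G] {m : ℕ} (f : Fin m → G) (j : ℕ) (h : j + 1 < m) :
    ascProd f ⟨j, by omega⟩ = f ⟨j, by omega⟩ * ascProd f ⟨j + 1, h⟩ := by
  induction m generalizing j with
  | zero => omega
  | succ m ih =>
    cases j with
    | zero =>
      obtain ⟨m, rfl⟩ : ∃ m', m = m' + 1 := ⟨m - 1, by omega⟩
      have h1 := ascProd_zero f
      have h2 := ascProd_succ f 0
      have h3 := ascProd_zero (fun t => f t.succ)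
      rw [List.finRange_succ] at h1
      change ascProd f 0 = f 0 * ascProd f (Fin.succ 0)
      rw [h1, h2, h3]
      simp [Function.comp_def]
    | succ j =>
      have := ih (fun t => f t.succ) j (by omega)
      have h1 := ascProd_succ f ⟨j, by omega⟩
      have h2 := ascProd_succ f ⟨j + 1, by omega⟩
      exact h1.trans (this.trans (congrArg _ h2.symm))

theorem ascProd_last {G : Type*} [Monoid G] {m : ℕ} (f : Fin m → G) (j : ℕ) (h : j + 1 = m) :
    ascProd f ⟨j, by omega⟩ = f ⟨j, by omega⟩ := by
  induction m generalizing j with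
  | zero => omega
  | succ m ih =>
    cases j with
    | zero =>
      obtain rfl : m = 0 := by omega
      exact (ascProd_zero f).trans (by simp)
    | succ j =>
      exact (ascProd_succ f ⟨j, by omega⟩).trans (ih (fun t => f t.succ) j (by omega))

theorem descProd_step {G : Type*} [Monoid G] {m : ℕ} (f : Fin m → G) (j : ℕ) (h : j + 1 < m) :
    descProd f ⟨j + 1, h⟩ = f ⟨j + 1, h⟩ * descProd f ⟨j, by omega⟩ := by
  induction m generalizing j with
  | zero => omega
  | succ m ih =>
    cases j with
    | zero =>
      obtain ⟨m, rfl⟩ : ∃ m', m = m' + 1 := ⟨m - 1, by omega⟩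
      change descProd f (Fin.succ 0) = f (Fin.succ 0) * descProd f 0
      rw [descProd_succ, descProd_zero, descProd_zero]
    | succ j =>
      have := ih (fun t => f t.succ) j (by omega)
      have h1 := descProd_succ f ⟨j, by omega⟩
      have h2 := descProd_succ f ⟨j + 1, by omega⟩
      refine h2.trans ?_
      refine Eq.trans ?_ (congrArg _ h1.symm)
      rw [this, mul_assoc]
      rfl

theorem descProd_first {G : Type*} [Monoid G] {m : ℕ} (f : Fin m → G) (h : 0 < m) :
    descProd f ⟨0, h⟩ = f ⟨0, h⟩ := by
  obtain ⟨m, rfl⟩ : ∃ m', m = m' + 1 := ⟨m - 1, by omega⟩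
  exact descProd_zero f

section main
variable {n m : ℕ} {H : Type*} [Group H]

/-- The first family of relations, in an arbitrary group. -/
def RelD (s : ℕ → ℤ) (b d : ZMod n → Fin m → H) : Prop :=
  ∀ k j, d k j = ascProd (fun t => b k t ^ s t.val) j *
    (ascProd (fun t => b (k - 1) t ^ s t.val) j)⁻¹

/-- The second family of relations, in an arbitrary group. -/
def RelB (q : ℕ → ℤ) (b d : ZMod n → Fin m → H) : Prop :=
  ∀ k j, b k j = descProd (fun t => d k t ^ q t.val) j *
    (descProd (fun t => d (k + 1) t ^ q t.val) j)⁻¹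

theorem RelD_iff (hm : 1 ≤ m) (s : ℕ → ℤ) (b d : ZMod n → Fin m → H) :
    RelD s b d ↔
      (∀ k j, ∀ h : j + 1 < m, d k ⟨j + 1, h⟩ =
        b k ⟨j, by omega⟩ ^ (-s j) * d k ⟨j, by omega⟩ * b (k - 1) ⟨j, by omega⟩ ^ s j) ∧
      ∀ k, b k ⟨m - 1, by omega⟩ ^ (-s (m - 1)) * d k ⟨m - 1, by omega⟩ *
        b (k - 1) ⟨m - 1, by omega⟩ ^ s (m - 1) = 1 := by
  constructor
  · intro hR
    refine ⟨fun k j h => ?_, fun k => ?_⟩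
    · rw [hR k ⟨j + 1, h⟩, hR k ⟨j, by omega⟩, ascProd_step _ j h, ascProd_step _ j h]
      simp only [zpow_neg]
      group
    · rw [hR k ⟨m - 1, by omega⟩, ascProd_last _ (m - 1) (by omega),
        ascProd_last _ (m - 1) (by omega)]
      simp only [zpow_neg]
      group
  · rintro ⟨h1, h2⟩
    have key : ∀ i j, ∀ h : j + 1 + i = m, ∀ k, d k ⟨j, by omega⟩ =
        ascProd (fun t => b k t ^ s t.val) ⟨j, by omega⟩ *
        (ascProd (fun t => b (k - 1) t ^ s t.val) ⟨j, by omega⟩)⁻¹ := by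
      intro i
      induction i with
      | zero =>
        intro j h k
        rw [ascProd_last _ j (by omega), ascProd_last _ j (by omega)]
        obtain rfl : j = m - 1 := by omega
        have := h2 k
        rw [zpow_neg, mul_assoc, inv_mul_eq_one] at this
        simp only [this]
        group
      | succ i ih =>
        intro j h k
        rw [ascProd_step _ j (by omega), ascProd_step _ j (by omega)]
        have e := ih (j + 1) (by omega) k
        rw [h1 k j (by omega), zpow_neg, mul_assoc, inv_mul_eq_iff_eq_mul,
          ← eq_mul_inv_iff_mul_eq] at e
        rw [e]
        group
    exact fun k j => key (m - 1 - j) j (by omega) k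

theorem RelB_iff (hm : 1 ≤ m) (q : ℕ → ℤ) (b d : ZMod n → Fin m → H) :
    RelB q b d ↔
      (∀ k, b k ⟨0, hm⟩ = d k ⟨0, hm⟩ ^ q 0 * d (k + 1) ⟨0, hm⟩ ^ (-q 0)) ∧
      (∀ k j, ∀ h : j + 1 < m, b k ⟨j + 1, h⟩ =
        d k ⟨j + 1, h⟩ ^ q (j + 1) * b k ⟨j, by omega⟩ * d (k + 1) ⟨j + 1, h⟩ ^ (-q (j + 1))) := by
  constructor
  · intro hR
    refine ⟨fun k => ?_, fun k j h => ?_⟩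
    · rw [hR k ⟨0, hm⟩, descProd_first _ hm, descProd_first _ hm, zpow_neg]
    · rw [hR k ⟨j + 1, h⟩, hR k ⟨j, by omega⟩, descProd_step _ j h, descProd_step _ j h]
      simp only [zpow_neg]
      group
  · rintro ⟨h1, h2⟩
    have key : ∀ j, ∀ h : j < m, ∀ k, b k ⟨j, h⟩ =
        descProd (fun t => d k t ^ q t.val) ⟨j, h⟩ *
        (descProd (fun t => d (k + 1) t ^ q t.val) ⟨j, h⟩)⁻¹ := by
      intro j
      induction j with
      | zero =>
        intro h k
        rw [h1, descProd_first _ hm, descProd_first _ hm, zpow_neg]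
      | succ j ih =>
        intro h k
        rw [h2, ih (by omega) k, descProd_step _ j h, descProd_step _ j h]
        simp only [zpow_neg]
        group
    exact fun k j => key j j.2 k

theorem lift_DB (q s : ℕ → ℤ) (hm : 1 ≤ m) (b d : ZMod n → Fin m → H)
    (hD : RelD s b d) (hB : RelB q b d) (F : FreeGroup (ZMod n) →* H)
    (hF : ∀ k, F (FreeGroup.of k) = d k ⟨0, hm⟩) :
    ∀ j, ∀ h : j < m, ∀ k,
      F ((DB n q s j).1 k) = d k ⟨j, h⟩ ∧ F ((DB n q s j).2 k) = b k ⟨j, h⟩ := by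
  rw [RelD_iff hm] at hD
  rw [RelB_iff hm] at hB
  intro j
  induction j with
  | zero =>
    intro h k
    simp only [DB, map_mul, map_zpow, hF, hB.1, and_self]
  | succ j ih =>
    intro h
    have ih := ih (by omega)
    have e : ∀ k, F ((DB n q s (j + 1)).1 k) = d k ⟨j + 1, h⟩ := by
      intro k
      simp only [DB, map_mul, map_zpow, (ih _).1, (ih _).2, hD.1]
    intro k
    refine ⟨e k, ?_⟩
    have : F ((DB n q s (j + 1)).2 k) = F ((DB n q s (j + 1)).1 k) ^ q (j + 1) *
        F ((DB n q s j).2 k) * F ((DB n q s (j + 1)).1 (k + 1)) ^ (-q (j + 1)) := by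
      simp only [DB, map_mul, map_zpow]
    rw [this, e, e, (ih _).2, hB.2]

theorem lift_w (q s : ℕ → ℤ) (hm : 1 ≤ m) (b d : ZMod n → Fin m → H)
    (hD : RelD s b d) (hB : RelB q b d) (F : FreeGroup (ZMod n) →* H)
    (hF : ∀ k, F (FreeGroup.of k) = d k ⟨0, hm⟩) (k : ZMod n) : F (w n m q s k) = 1 := by
  have key := lift_DB q s hm b d hD hB F hF (m - 1) (by omega)
  rw [w, map_mul, map_mul, map_zpow, map_zpow, (key _).1, (key _).2, (key _).2]
  exact ((RelD_iff hm s b d).1 hD).2 k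

theorem rel_of_w (q s : ℕ → ℤ) (hm : 1 ≤ m) (F : FreeGroup (ZMod n) →* H)
    (hF : ∀ k, F (w n m q s k) = 1) :
    RelD s (fun k (j : Fin m) => F ((DB n q s j).2 k)) (fun k j => F ((DB n q s j).1 k)) ∧
    RelB q (fun k (j : Fin m) => F ((DB n q s j).2 k)) (fun k j => F ((DB n q s j).1 k)) := by
  rw [RelD_iff hm, RelB_iff hm]
  refine ⟨⟨?_, ?_⟩, ?_, ?_⟩
  · intro k j h
    simp only [DB, map_mul, map_zpow]
  · intro k
    simpa only [w, map_mul, map_zpow] using hF k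
  · intro k
    simp only [DB, map_mul, map_zpow]
  · intro k j h
    simp only [DB, map_mul, map_zpow]

theorem lift_rels (q s : ℕ → ℤ) (F : FreeGroup ((ZMod n × Fin m) ⊕ (ZMod n × Fin m)) →* H) :
    (∀ r ∈ relsLeft n m q s, F r = 1) ↔
      RelD s (fun k j => F (bg k j)) (fun k j => F (dg k j)) ∧
      RelB q (fun k j => F (bg k j)) (fun k j => F (dg k j)) := by
  simp only [relsLeft, Set.mem_union, or_imp, forall_and, Set.forall_mem_range, RelD, RelB,
    map_mul, map_inv, map_ascProd, map_descProd, map_zpow, Prod.forall]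
  simp only [mul_inv_eq_one]

end main

/-- The paper's Theorem 5 (group-theoretic content): the presented group on the
`b_{k,j}, d_{k,j}` is isomorphic to the cyclically presented group with relators `w_k`,
via an isomorphism carrying `d_{k,1}` to `x_k`. -/
theorem stmt2 (n m : ℕ) (hn : 1 ≤ n) (hm : 1 ≤ m) (q s : ℕ → ℤ) :
    ∃ φ : PresentedGroup (relsLeft n m q s) ≃* PresentedGroup (Set.range (w n m q s)),
      ∀ k : ZMod n,
        φ (PresentedGroup.of (Sum.inr (k, ⟨0, hm⟩))) = PresentedGroup.of k := by
  classical
  let Q := PresentedGroup (relsLeft n m q s)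
  let P := PresentedGroup (Set.range (w n m q s))
  let pQ : FreeGroup ((ZMod n × Fin m) ⊕ (ZMod n × Fin m)) →* Q := PresentedGroup.mk _
  let pP : FreeGroup (ZMod n) →* P := PresentedGroup.mk _
  have hQ := (lift_rels q s pQ).1 (fun r hr => PresentedGroup.one_of_mem hr)
  have hP := rel_of_w (m := m) q s hm pP
    (fun k => PresentedGroup.one_of_mem (Set.mem_range_self k))
  let f : (ZMod n × Fin m) ⊕ (ZMod n × Fin m) → P :=
    Sum.elim (fun kj => pP ((DB n q s kj.2).2 kj.1)) (fun kj => pP ((DB n q s kj.2).1 kj.1))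
  have hf : ∀ r ∈ relsLeft n m q s, FreeGroup.lift f r = 1 := by
    rw [lift_rels]
    simpa [bg, dg, f] using hP
  let g : ZMod n → Q := fun k => pQ (dg k ⟨0, hm⟩)
  have hg0 : ∀ k, FreeGroup.lift g (FreeGroup.of k) = pQ (dg k ⟨0, hm⟩) := fun k => by simp [g]
  have hg : ∀ r ∈ Set.range (w n m q s), FreeGroup.lift g r = 1 := by
    rintro _ ⟨k, rfl⟩
    exact lift_w q s hm _ _ hQ.1 hQ.2 _ hg0 k
  have key := lift_DB q s hm _ _ hQ.1 hQ.2 _ hg0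
  let Φ : Q →* P := PresentedGroup.toGroup hf
  let Ψ : P →* Q := PresentedGroup.toGroup hg
  have h0 : ∀ k, Φ (PresentedGroup.of (Sum.inr (k, ⟨0, hm⟩))) = PresentedGroup.of k := by
    intro k
    exact PresentedGroup.toGroup.of hf
  have h1 : Ψ.comp Φ = MonoidHom.id Q := by
    apply PresentedGroup.ext
    rintro (⟨k, j⟩ | ⟨k, j⟩)
    · have e : Φ (PresentedGroup.of (Sum.inl (k, j))) = f (Sum.inl (k, j)) :=
        PresentedGroup.toGroup.of hf
      refine Eq.trans (congrArg Ψ e) ?_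
      exact (key j j.2 k).2
    · have e : Φ (PresentedGroup.of (Sum.inr (k, j))) = f (Sum.inr (k, j)) :=
        PresentedGroup.toGroup.of hf
      refine Eq.trans (congrArg Ψ e) ?_
      exact (key j j.2 k).1
  have h2 : Φ.comp Ψ = MonoidHom.id P := by
    apply PresentedGroup.ext
    intro k
    refine Eq.trans (congrArg Φ (PresentedGroup.toGroup.of hg)) ?_
    exact h0 k
  exact ⟨MonoidHom.toMulEquiv Φ Ψ h1 h2, h0⟩

end Stmt2
end

section
/- Let n ≥ 1 and let q, s be integers. The presented group with generators b_k, d_k (k ∈ ℤ/n) and relators b_k^{-s} d_k b_{k-1}^{s} and b_k · (d_k^{q} d_{k+1}^{-q})^{-1} for all k ∈ ℤ/n is isomorphic to the presented group with generators x_k (k ∈ ℤ/n) and relators (x_k^{q} x_{k+1}^{-q})^{-s} x_k (x_{k-1}^{q} x_k^{-q})^{s} for all k ∈ ℤ/n, via an isomorphism carrying d_k to x_k. -/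
namespace Stmt3

/-- `b`-generators of the left presentation. -/
def bgen {n : ℕ} (k : ZMod n) : FreeGroup (ZMod n ⊕ ZMod n) := FreeGroup.of (Sum.inl k)

/-- `d`-generators of the left presentation. -/
def dgen {n : ℕ} (k : ZMod n) : FreeGroup (ZMod n ⊕ ZMod n) := FreeGroup.of (Sum.inr k)

/-- Relators `b_k^{-s} d_k b_{k-1}^{s}` and `b_k (d_k^q d_{k+1}^{-q})⁻¹`. -/
def relsLeft (n : ℕ) (q s : ℤ) : Set (FreeGroup (ZMod n ⊕ ZMod n)) :=
  Set.range (fun k : ZMod n => bgen k ^ (-s) * dgen k * bgen (k - 1) ^ s) ∪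
    Set.range (fun k : ZMod n => bgen k * (dgen k ^ q * dgen (k + 1) ^ (-q))⁻¹)

/-- Relators `(x_k^q x_{k+1}^{-q})^{-s} x_k (x_{k-1}^q x_k^{-q})^{s}`. -/
def relsRight (n : ℕ) (q s : ℤ) : Set (FreeGroup (ZMod n)) :=
  Set.range (fun k : ZMod n =>
    (FreeGroup.of k ^ q * FreeGroup.of (k + 1) ^ (-q)) ^ (-s) * FreeGroup.of k *
      (FreeGroup.of (k - 1) ^ q * FreeGroup.of k ^ (-q)) ^ s)

theorem right_rel (n : ℕ) (q s : ℤ) (k : ZMod n) :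
    ((PresentedGroup.of k : PresentedGroup (relsRight n q s)) ^ q *
      PresentedGroup.of (k + 1) ^ (-q)) ^ (-s) * PresentedGroup.of k *
      (PresentedGroup.of (k - 1) ^ q * PresentedGroup.of k ^ (-q)) ^ s = 1 := by
  have h := PresentedGroup.one_of_mem (rels := relsRight n q s) ⟨k, rfl⟩
  simp only [map_mul, map_zpow] at h
  exact h

theorem left_rel1 (n : ℕ) (q s : ℤ) (k : ZMod n) :
    (PresentedGroup.of (Sum.inl k) : PresentedGroup (relsLeft n q s)) ^ (-s) *
      PresentedGroup.of (Sum.inr k) * PresentedGroup.of (Sum.inl (k - 1)) ^ s = 1 := by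
  have h := PresentedGroup.one_of_mem (rels := relsLeft n q s) (Or.inl ⟨k, rfl⟩)
  simp only [map_mul, map_zpow] at h
  exact h

theorem left_rel2 (n : ℕ) (q s : ℤ) (k : ZMod n) :
    (PresentedGroup.of (Sum.inl k) : PresentedGroup (relsLeft n q s)) =
      PresentedGroup.of (Sum.inr k) ^ q * PresentedGroup.of (Sum.inr (k + 1)) ^ (-q) := by
  have h := PresentedGroup.one_of_mem (rels := relsLeft n q s) (Or.inr ⟨k, rfl⟩)
  simp only [map_mul, map_zpow, map_inv] at h
  exact mul_inv_eq_one.mp h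

/-- Images of the left generators. -/
def fwd (n : ℕ) (q s : ℤ) : ZMod n ⊕ ZMod n → PresentedGroup (relsRight n q s)
  | Sum.inl k => PresentedGroup.of k ^ q * PresentedGroup.of (k + 1) ^ (-q)
  | Sum.inr k => PresentedGroup.of k

theorem fwd_rels (n : ℕ) (q s : ℤ) :
    ∀ r ∈ relsLeft n q s, FreeGroup.lift (fwd n q s) r = 1 := by
  rintro r (⟨k, rfl⟩ | ⟨k, rfl⟩)
  · have h := right_rel n q s k
    simp only [bgen, dgen, map_mul, map_zpow, FreeGroup.lift_apply_of, fwd, sub_add_cancel]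
    exact h
  · simp only [bgen, dgen, map_mul, map_zpow, map_inv, FreeGroup.lift_apply_of, fwd]
    exact mul_inv_cancel _

theorem bwd_rels (n : ℕ) (q s : ℤ) :
    ∀ r ∈ relsRight n q s, FreeGroup.lift
      (fun k => (PresentedGroup.of (Sum.inr k) : PresentedGroup (relsLeft n q s))) r = 1 := by
  rintro r ⟨k, rfl⟩
  have h := left_rel1 n q s k
  rw [left_rel2 n q s k, left_rel2 n q s (k - 1), sub_add_cancel] at h
  simp only [map_mul, map_zpow, FreeGroup.lift_apply_of]
  exact h

/-- The `m = 1` case of the paper's Theorem 5: the two presented groups are isomorphic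
via an isomorphism carrying `d_k` to `x_k`. -/
theorem stmt3 (n : ℕ) (hn : 1 ≤ n) (q s : ℤ) :
    ∃ φ : PresentedGroup (relsLeft n q s) ≃* PresentedGroup (relsRight n q s),
      ∀ k : ZMod n, φ (PresentedGroup.of (Sum.inr k)) = PresentedGroup.of k := by
  refine ⟨MonoidHom.toMulEquiv (PresentedGroup.toGroup (fwd_rels n q s))
    (PresentedGroup.toGroup (bwd_rels n q s)) ?_ ?_, ?_⟩
  · apply PresentedGroup.ext
    rintro (k | k)
    · simp only [MonoidHom.comp_apply, PresentedGroup.toGroup.of, fwd, map_mul, map_zpow,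
        MonoidHom.id_apply]
      exact (left_rel2 n q s k).symm
    · simp only [MonoidHom.comp_apply, PresentedGroup.toGroup.of, fwd, MonoidHom.id_apply]
  · apply PresentedGroup.ext
    intro k
    simp only [MonoidHom.comp_apply, PresentedGroup.toGroup.of, fwd, MonoidHom.id_apply]
  · intro k
    exact PresentedGroup.toGroup.of (fwd_rels n q s) (x := Sum.inr k)

end Stmt3
end

section
/- Let n ≥ 1 and let q_1, q_2, s_1, s_2 be integers. Let G be the presented group with generators b_{k,1}, b_{k,2}, d_{k,1}, d_{k,2} (k ∈ ℤ/n) and relators expressing b_{k,2}^{-s_2} d_{k,2} b_{k-1,2}^{s_2} = 1, d_{k,2} = b_{k,1}^{-s_1} d_{k,1} b_{k-1,1}^{s_1}, b_{k,1} = d_{k,1}^{q_1} d_{k+1,1}^{-q_1}, and b_{k,2} = d_{k,2}^{q_2} b_{k,1} d_{k+1,2}^{-q_2} for all k ∈ ℤ/n. In the free group on generators x_k (k ∈ ℤ/n), define for each k the word w_k = [ [ (x_k^{q_1} x_{k+1}^{-q_1})^{-s_1} x_k (x_{k-1}^{q_1} x_k^{-q_1})^{s_1} ]^{q_2} · x_k^{q_1}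 x_{k+1}^{-q_1} · [ (x_{k+1}^{q_1} x_{k+2}^{-q_1})^{-s_1} x_{k+1} (x_k^{q_1} x_{k+1}^{-q_1})^{s_1} ]^{-q_2} ]^{-s_2} · (x_k^{q_1} x_{k+1}^{-q_1})^{-s_1} x_k (x_{k-1}^{q_1} x_k^{-q_1})^{s_1} · [ [ (x_{k-1}^{q_1} x_k^{-q_1})^{-s_1} x_{k-1} (x_{k-2}^{q_1} x_{k-1}^{-q_1})^{s_1} ]^{q_2} · x_{k-1}^{q_1} x_k^{-q_1} · [ (x_k^{q_1} x_{k+1}^{-q_1})^{-s_1} x_k (x_{k-1}^{q_1} x_k^{-q_1})^{s_1} ]^{-q_2} ]^{s_2}. Then G is isomorphic to the presented group with generators x_k (k ∈ ℤ/n) and relators w_k for all k, via an isomorphism carrying d_{k,1} to x_k. -/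
namespace Stmt5

/-- Generators of the presentation with four families `b_{k,1}, b_{k,2}, d_{k,1}, d_{k,2}`. -/
abbrev Gen (n : ℕ) := (ZMod n ⊕ ZMod n) ⊕ (ZMod n ⊕ ZMod n)

def b1 {n : ℕ} (k : ZMod n) : FreeGroup (Gen n) := FreeGroup.of (Sum.inl (Sum.inl k))
def b2 {n : ℕ} (k : ZMod n) : FreeGroup (Gen n) := FreeGroup.of (Sum.inl (Sum.inr k))
def d1 {n : ℕ} (k : ZMod n) : FreeGroup (Gen n) := FreeGroup.of (Sum.inr (Sum.inl k))
def d2 {n : ℕ} (k : ZMod n) : FreeGroup (Gen n) := FreeGroup.of (Sum.inr (Sum.inr k))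

/-- Relators of the left presentation (the `m = 2` case of the paper's Theorem 5). -/
def relsLeft (n : ℕ) (q1 q2 s1 s2 : ℤ) : Set (FreeGroup (Gen n)) :=
  Set.range (fun k : ZMod n => b2 k ^ (-s2) * d2 k * b2 (k - 1) ^ s2) ∪
    Set.range (fun k : ZMod n => d2 k * (b1 k ^ (-s1) * d1 k * b1 (k - 1) ^ s1)⁻¹) ∪
    Set.range (fun k : ZMod n => b1 k * (d1 k ^ q1 * d1 (k + 1) ^ (-q1))⁻¹) ∪
    Set.range (fun k : ZMod n => b2 k * (d2 k ^ q2 * b1 k * d2 (k + 1) ^ (-q2))⁻¹)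

/-- The word `x_k^{q1} x_{k+1}^{-q1}`. -/
def A (n : ℕ) (q1 : ℤ) (k : ZMod n) : FreeGroup (ZMod n) :=
  FreeGroup.of k ^ q1 * FreeGroup.of (k + 1) ^ (-q1)

/-- The word `(x_k^{q1} x_{k+1}^{-q1})^{-s1} x_k (x_{k-1}^{q1} x_k^{-q1})^{s1}`. -/
def E (n : ℕ) (q1 s1 : ℤ) (k : ZMod n) : FreeGroup (ZMod n) :=
  A n q1 k ^ (-s1) * FreeGroup.of k * A n q1 (k - 1) ^ s1

/-- The cyclic relator `w_k` of the paper's `m = 2` example. -/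
def w (n : ℕ) (q1 q2 s1 s2 : ℤ) (k : ZMod n) : FreeGroup (ZMod n) :=
  (E n q1 s1 k ^ q2 * A n q1 k * E n q1 s1 (k + 1) ^ (-q2)) ^ (-s2) *
    E n q1 s1 k *
    (E n q1 s1 (k - 1) ^ q2 * A n q1 (k - 1) * E n q1 s1 k ^ (-q2)) ^ s2

/-- Relators of the cyclic presentation. -/
def relsRight (n : ℕ) (q1 q2 s1 s2 : ℤ) : Set (FreeGroup (ZMod n)) :=
  Set.range (w n q1 q2 s1 s2)

/-- Images of the generators of the left presentation, as words in the `x_k`. -/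
def fwdWord (n : ℕ) (q1 q2 s1 : ℤ) : Gen n → FreeGroup (ZMod n)
  | Sum.inl (Sum.inl k) => A n q1 k
  | Sum.inl (Sum.inr k) => E n q1 s1 k ^ q2 * A n q1 k * E n q1 s1 (k + 1) ^ (-q2)
  | Sum.inr (Sum.inl k) => FreeGroup.of k
  | Sum.inr (Sum.inr k) => E n q1 s1 k

theorem fwd_rels (n : ℕ) (q1 q2 s1 s2 : ℤ) :
    ∀ r ∈ relsLeft n q1 q2 s1 s2,
      FreeGroup.lift (fun g => PresentedGroup.mk (relsRight n q1 q2 s1 s2)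
        (fwdWord n q1 q2 s1 g)) r = 1 := by
  have key : FreeGroup.lift (fun g => PresentedGroup.mk (relsRight n q1 q2 s1 s2)
        (fwdWord n q1 q2 s1 g)) = (PresentedGroup.mk (relsRight n q1 q2 s1 s2)).comp
        (FreeGroup.lift (fwdWord n q1 q2 s1)) := by
    ext g
    simp
  rw [key]
  rintro r (((⟨k, rfl⟩ | ⟨k, rfl⟩) | ⟨k, rfl⟩) | ⟨k, rfl⟩)
  · have h : PresentedGroup.mk (relsRight n q1 q2 s1 s2) (w n q1 q2 s1 s2 k) = 1 :=
      PresentedGroup.one_of_mem ⟨k, rfl⟩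
    rw [← h, MonoidHom.comp_apply]
    congr 1
    simp only [b2, d2, map_mul, map_zpow, FreeGroup.lift_apply_of, fwdWord, w, sub_add_cancel]
  · rw [MonoidHom.comp_apply]
    simp only [b1, d1, d2, map_mul, map_inv, map_zpow, FreeGroup.lift_apply_of, fwdWord, E]
    group
  · rw [MonoidHom.comp_apply]
    simp only [b1, d1, map_mul, map_inv, map_zpow, FreeGroup.lift_apply_of, fwdWord, A]
    group
  · rw [MonoidHom.comp_apply]
    simp only [b1, b2, d2, map_mul, map_inv, map_zpow, FreeGroup.lift_apply_of, fwdWord]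
    group

/-- The substitution `x_k ↦ d_{k,1}`. -/
def bwd (n : ℕ) (q1 q2 s1 s2 : ℤ) :
    FreeGroup (ZMod n) →* PresentedGroup (relsLeft n q1 q2 s1 s2) :=
  FreeGroup.lift (fun k => PresentedGroup.mk _ (d1 k))

theorem bwd_A (n : ℕ) (q1 q2 s1 s2 : ℤ) (k : ZMod n) :
    bwd n q1 q2 s1 s2 (A n q1 k) = PresentedGroup.mk _ (b1 k) := by
  have h : PresentedGroup.mk (relsLeft n q1 q2 s1 s2)
      (b1 k * (d1 k ^ q1 * d1 (k + 1) ^ (-q1))⁻¹) = 1 :=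
    PresentedGroup.one_of_mem (Or.inl (Or.inr ⟨k, rfl⟩))
  rw [map_mul, map_inv, mul_inv_eq_one] at h
  rw [h]
  simp only [bwd, A, map_mul, map_zpow, FreeGroup.lift_apply_of]

theorem bwd_E (n : ℕ) (q1 q2 s1 s2 : ℤ) (k : ZMod n) :
    bwd n q1 q2 s1 s2 (E n q1 s1 k) = PresentedGroup.mk _ (d2 k) := by
  have h : PresentedGroup.mk (relsLeft n q1 q2 s1 s2)
      (d2 k * (b1 k ^ (-s1) * d1 k * b1 (k - 1) ^ s1)⁻¹) = 1 :=
    PresentedGroup.one_of_mem (Or.inl (Or.inl (Or.inr ⟨k, rfl⟩)))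
  rw [map_mul, map_inv, mul_inv_eq_one] at h
  rw [h]
  simp only [E, map_mul, map_zpow, bwd_A]
  simp only [bwd, FreeGroup.lift_apply_of]

theorem bwd_B (n : ℕ) (q1 q2 s1 s2 : ℤ) (k : ZMod n) :
    bwd n q1 q2 s1 s2 (E n q1 s1 k ^ q2 * A n q1 k * E n q1 s1 (k + 1) ^ (-q2)) =
      PresentedGroup.mk _ (b2 k) := by
  have h : PresentedGroup.mk (relsLeft n q1 q2 s1 s2)
      (b2 k * (d2 k ^ q2 * b1 k * d2 (k + 1) ^ (-q2))⁻¹) = 1 :=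
    PresentedGroup.one_of_mem (Or.inr ⟨k, rfl⟩)
  rw [map_mul, map_inv, mul_inv_eq_one] at h
  rw [h]
  simp only [map_mul, map_zpow, bwd_A, bwd_E]

theorem bwd_rels (n : ℕ) (q1 q2 s1 s2 : ℤ) :
    ∀ r ∈ relsRight n q1 q2 s1 s2,
      FreeGroup.lift (fun k => PresentedGroup.mk (relsLeft n q1 q2 s1 s2) (d1 k)) r = 1 := by
  rintro r ⟨k, rfl⟩
  change bwd n q1 q2 s1 s2 _ = 1
  have h : PresentedGroup.mk (relsLeft n q1 q2 s1 s2)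
      (b2 k ^ (-s2) * d2 k * b2 (k - 1) ^ s2) = 1 :=
    PresentedGroup.one_of_mem (Or.inl (Or.inl (Or.inl ⟨k, rfl⟩)))
  have h' := bwd_B n q1 q2 s1 s2 (k - 1)
  rw [sub_add_cancel] at h'
  rw [← h, w, map_mul, map_mul, map_zpow, map_zpow, bwd_B, h', bwd_E]
  simp only [map_mul, map_zpow]

/-- The `m = 2` case of the paper's Theorem 5: the two presented groups are isomorphic
via an isomorphism carrying `d_{k,1}` to `x_k`. -/
theorem stmt5 (n : ℕ) (hn : 1 ≤ n) (q1 q2 s1 s2 : ℤ) :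
    ∃ φ : PresentedGroup (relsLeft n q1 q2 s1 s2) ≃*
        PresentedGroup (relsRight n q1 q2 s1 s2),
      ∀ k : ZMod n,
        φ (PresentedGroup.of (Sum.inr (Sum.inl k))) = PresentedGroup.of k := by
  let f := PresentedGroup.toGroup (fwd_rels n q1 q2 s1 s2)
  let g := PresentedGroup.toGroup (bwd_rels n q1 q2 s1 s2)
  have hg : ∀ x, g (PresentedGroup.mk _ x) = bwd n q1 q2 s1 s2 x := fun x => rfl
  have hf : ∀ x, f (PresentedGroup.of x) = PresentedGroup.mk _ (fwdWord n q1 q2 s1 x) :=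
    fun x => PresentedGroup.toGroup.of _
  have h1 : g.comp f = MonoidHom.id _ := by
    refine PresentedGroup.ext fun x => ?_
    rw [MonoidHom.comp_apply, hf, hg, MonoidHom.id_apply]
    rcases x with (k | k) | (k | k)
    · exact bwd_A n q1 q2 s1 s2 k
    · exact bwd_B n q1 q2 s1 s2 k
    · exact FreeGroup.lift_apply_of
    · exact bwd_E n q1 q2 s1 s2 k
  have h2 : f.comp g = MonoidHom.id _ := by
    refine PresentedGroup.ext fun k => ?_
    have : g (PresentedGroup.of k) = PresentedGroup.of (Sum.inr (Sum.inl k)) :=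
      PresentedGroup.toGroup.of _
    rw [MonoidHom.comp_apply, this, hf]
    rfl
  exact ⟨MonoidHom.toMulEquiv f g h1 h2, fun k => hf _⟩

end Stmt5
end
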